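/- For every n ≥ 3 with n ≠ 5, f(n, C₃) = 2^{n-2}: the power set 𝒫(n) can be partitioned into 2^{n-2} triangle-free parts, but in any partition of 𝒫(n) into 2^{n-2} − 1 parts some part contains a Berge triangle. -/

import Mathlib

/-- Three distinct sets `A, B, C ⊆ [n]` form a Berge triangle if there exist pairwise
distinct elements `x ∈ A ∩ B`, `y ∈ A ∩ C`, `z ∈ B ∩ C`. -/
def BergeTriangle {n : ℕ} (A B C : Finset (Fin n)) : Prop :=
  A ≠ B ∧ A ≠ C ∧ B ≠ C ∧
    ∃ x y z : Fin n, x ≠ y ∧ x ≠ z ∧ y ≠ z ∧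
      x ∈ A ∩ B ∧ y ∈ A ∩ C ∧ z ∈ B ∩ C

/-- A family of subsets of `[n]` is triangle-free if no three of its members form a
Berge triangle. -/
def TriangleFree {n : ℕ} (F : Set (Finset (Fin n))) : Prop :=
  ∀ A ∈ F, ∀ B ∈ F, ∀ C ∈ F, ¬ BergeTriangle A B C



open Finset in
lemma hall3 {α : Type*} [DecidableEq α] (P Q R : Finset α) (hP : 1 ≤ #P) (hQ : 1 ≤ #Q) (hR : 1 ≤ #R)
    (hPQ : 2 ≤ #(P ∪ Q)) (hPR : 2 ≤ #(P ∪ R)) (hQR : 2 ≤ #(Q ∪ R)) (h3 : 3 ≤ #(P ∪ (Q ∪ R))) :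
    ∃ x y z, x ≠ y ∧ x ≠ z ∧ y ≠ z ∧ x ∈ P ∧ y ∈ Q ∧ z ∈ R := by
  have key := (Finset.all_card_le_biUnion_card_iff_exists_injective (![P, Q, R])).1 (by
    intro s
    have hs : s = ∅ ∨ s = {0} ∨ s = {1} ∨ s = {2} ∨ s = {0, 1} ∨ s = {0, 2} ∨ s = {1, 2} ∨
        s = {0, 1, 2} := by
      revert s; decide
    rcases hs with h | h | h | h | h | h | h | h <;> subst h <;>
      simp [Finset.biUnion_insert] <;> first | omega | simpa using hP | simpa using hQ | simpa using hR)
  obtain ⟨f, hf, hm⟩ := key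
  refine ⟨f 0, f 1, f 2, ?_, ?_, ?_, hm 0, hm 1, hm 2⟩ <;> exact fun h => by simpa using hf h

open Finset in
/-- Linear facts about the intersection sizes of three sets. -/
lemma facts3 {n : ℕ} (A B C : Finset (Fin n)) :
    #(A ∩ B ∩ C) ≤ #(A ∩ B) ∧ #(A ∩ B ∩ C) ≤ #(A ∩ C) ∧ #(A ∩ B ∩ C) ≤ #(B ∩ C) ∧
    #(A ∩ B) + #(A ∩ C) = #((A ∩ B) ∪ (A ∩ C)) + #(A ∩ B ∩ C) ∧
    #(A ∩ B) + #(B ∩ C) = #((A ∩ B) ∪ (B ∩ C)) + #(A ∩ B ∩ C) ∧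
    #(A ∩ C) + #(B ∩ C) = #((A ∩ C) ∪ (B ∩ C)) + #(A ∩ B ∩ C) ∧
    #(A ∩ B) + #(A ∩ C) + #(B ∩ C) =
      #((A ∩ B) ∪ ((A ∩ C) ∪ (B ∩ C))) + 2 * #(A ∩ B ∩ C) ∧
    #(A ∩ B) + #(A ∩ C) ≤ #A + #(A ∩ B ∩ C) ∧
    #(A ∩ B) + #(B ∩ C) ≤ #B + #(A ∩ B ∩ C) ∧
    #(A ∩ C) + #(B ∩ C) ≤ #C + #(A ∩ B ∩ C) ∧
    #A + #B ≤ n + #(A ∩ B) ∧ #A + #C ≤ n + #(A ∩ C) ∧ #B + #C ≤ n + #(B ∩ C) ∧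
    #A + #B + #C + #(A ∩ B ∩ C) ≤ n + #(A ∩ B) + #(A ∩ C) + #(B ∩ C) := by
  have e1 : (A ∩ B) ∩ (A ∩ C) = A ∩ B ∩ C := by grind
  have e2 : (A ∩ B) ∩ (B ∩ C) = A ∩ B ∩ C := by grind
  have e3 : (A ∩ C) ∩ (B ∩ C) = A ∩ B ∩ C := by grind
  have e4 : (A ∩ B) ∩ ((A ∩ C) ∪ (B ∩ C)) = A ∩ B ∩ C := by grind
  have e5 : (A ∪ B) ∩ C = (A ∩ C) ∪ (B ∩ C) := by grind
  have u1 := card_union_add_card_inter (A ∩ B) (A ∩ C)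
  have u2 := card_union_add_card_inter (A ∩ B) (B ∩ C)
  have u3 := card_union_add_card_inter (A ∩ C) (B ∩ C)
  have u4 := card_union_add_card_inter (A ∩ B) ((A ∩ C) ∪ (B ∩ C))
  have u5 := card_union_add_card_inter A B
  have u6 := card_union_add_card_inter A C
  have u7 := card_union_add_card_inter B C
  have u8 := card_union_add_card_inter (A ∪ B) C
  rw [e1] at u1; rw [e2] at u2; rw [e3] at u3; rw [e4] at u4; rw [e5] at u8
  have c1 : #(A ∩ B ∩ C) ≤ #(A ∩ B) := card_le_card (by grind)
  have c2 : #(A ∩ B ∩ C) ≤ #(A ∩ C) := card_le_card (by grind)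
  have c3 : #(A ∩ B ∩ C) ≤ #(B ∩ C) := card_le_card (by grind)
  have d1 : #((A ∩ B) ∪ (A ∩ C)) ≤ #A := card_le_card (by grind)
  have d2 : #((A ∩ B) ∪ (B ∩ C)) ≤ #B := card_le_card (by grind)
  have d3 : #((A ∩ C) ∪ (B ∩ C)) ≤ #C := card_le_card (by grind)
  have n1 := card_finset_fin_le (A ∪ B)
  have n2 := card_finset_fin_le (A ∪ C)
  have n3 := card_finset_fin_le (B ∪ C)
  have n4 := card_finset_fin_le (A ∪ B ∪ C)
  refine ⟨c1, c2, c3, ?_, ?_, ?_, ?_, ?_, ?_, ?_, ?_, ?_, ?_, ?_⟩ <;> omega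

open Finset in
lemma nontri {n : ℕ} (A B C : Finset (Fin n)) (h : ¬ BergeTriangle A B C) (hAB : A ≠ B) (hAC : A ≠ C)
    (hBC : B ≠ C) : #(A ∩ B) = 0 ∨ #(A ∩ C) = 0 ∨ #(B ∩ C) = 0 ∨
    #(A ∩ B) + #(A ∩ C) ≤ 1 + #(A ∩ B ∩ C) ∨ #(A ∩ B) + #(B ∩ C) ≤ 1 + #(A ∩ B ∩ C) ∨
    #(A ∩ C) + #(B ∩ C) ≤ 1 + #(A ∩ B ∩ C) ∨
    #(A ∩ B) + #(A ∩ C) + #(B ∩ C) ≤ 2 + 2 * #(A ∩ B ∩ C) := by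
  by_contra hc
  have f := facts3 A B C
  exact h ⟨hAB, hAC, hBC, hall3 _ _ _ (by omega) (by omega) (by omega) (by omega) (by omega)
    (by omega) (by omega)⟩

open Finset in
lemma ne_card {n : ℕ} {A B : Finset (Fin n)} (h : A ≠ B) : #(A ∩ B) < #A ∨ #(A ∩ B) < #B := by
  by_contra hc
  push Not at hc
  exact h ((eq_of_subset_of_card_le inter_subset_left hc.1).symm.trans
    (eq_of_subset_of_card_le inter_subset_right hc.2))

open Finset in
lemma inter_le {n : ℕ} (A B : Finset (Fin n)) : #(A ∩ B) ≤ #A ∧ #(A ∩ B) ≤ #B :=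
  ⟨card_le_card inter_subset_left, card_le_card inter_subset_right⟩

open Finset in
/-- three large sets form a triangle -/
lemma three_large {n : ℕ} (hn : 4 ≤ n) (hn5 : n ≠ 5) (A B C : Finset (Fin n)) (hA : n < 2 * #A)
    (hB : n < 2 * #B) (hC : n < 2 * #C) (hAB : A ≠ B) (hAC : A ≠ C) (hBC : B ≠ C) :
    BergeTriangle A B C := by
  by_contra h
  have f := facts3 A B C
  have t := nontri A B C h hAB hAC hBC
  have := ne_card hAB
  have := ne_card hAC
  have := ne_card hBC
  have := inter_le A B
  have := inter_le A C
  have := inter_le B C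
  rcases t with t | t | t | t | t | t | t <;> omega

open Finset in
/-- two large sets and a middle set form a triangle -/
lemma two_large {n : ℕ} (hn : 6 ≤ n) (A B C : Finset (Fin n)) (hA : n < 2 * #A)
    (hB : n < 2 * #B) (hC : n = 2 * #C) (hAB : A ≠ B) (hAC : A ≠ C) (hBC : B ≠ C) :
    BergeTriangle A B C := by
  by_contra h
  have f := facts3 A B C
  have t := nontri A B C h hAB hAC hBC
  have := ne_card hAB
  have := ne_card hAC
  have := ne_card hBC
  have := inter_le A B
  have := inter_le A C
  have := inter_le B C
  rcases t with t | t | t | t | t | t | t <;> omega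

open Finset in
lemma facts4 {n : ℕ} (C A B E : Finset (Fin n)) :
    #(C ∩ A ∩ B ∩ E) ≤ #(C ∩ A ∩ B) ∧ #(C ∩ A ∩ B ∩ E) ≤ #(C ∩ A ∩ E) ∧
    #(C ∩ A ∩ B ∩ E) ≤ #(C ∩ B ∩ E) ∧ #(C ∩ A ∩ B ∩ E) ≤ #(A ∩ B ∩ E) ∧
    #(C ∩ A ∩ B) + #(C ∩ A ∩ E) ≤ #(C ∩ A) + #(C ∩ A ∩ B ∩ E) ∧
    #(C ∩ A ∩ B) + #(C ∩ B ∩ E) ≤ #(C ∩ B) + #(C ∩ A ∩ B ∩ E) ∧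
    #(C ∩ A ∩ E) + #(C ∩ B ∩ E) ≤ #(C ∩ E) + #(C ∩ A ∩ B ∩ E) ∧
    #(C ∩ A ∩ B) + #(A ∩ B ∩ E) ≤ #(A ∩ B) + #(C ∩ A ∩ B ∩ E) ∧
    #(C ∩ A ∩ E) + #(A ∩ B ∩ E) ≤ #(A ∩ E) + #(C ∩ A ∩ B ∩ E) ∧
    #(C ∩ B ∩ E) + #(A ∩ B ∩ E) ≤ #(B ∩ E) + #(C ∩ A ∩ B ∩ E) ∧
    #C + #A + #B + #E + #(C ∩ A ∩ B) + #(C ∩ A ∩ E) + #(C ∩ B ∩ E) + #(A ∩ B ∩ E) =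
      #(C ∪ A ∪ B ∪ E) + #(C ∩ A) + #(C ∩ B) + #(C ∩ E) + #(A ∩ B) + #(A ∩ E) + #(B ∩ E)
       + #(C ∩ A ∩ B ∩ E) := by
  have key : ∀ X Y Z W : Finset (Fin n), X ∩ Y = W → X ⊆ Z → Y ⊆ Z → #X + #Y ≤ #Z + #W := by
    intro X Y Z W h hX hY
    have := card_union_add_card_inter X Y
    have := card_le_card (union_subset hX hY)
    rw [h] at *
    omega
  refine ⟨?_, ?_, ?_, ?_, ?_, ?_, ?_, ?_, ?_, ?_, ?_⟩
  iterate 4 exact card_le_card (by grind)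
  iterate 6 exact key _ _ _ _ (by grind) (by grind) (by grind)
  have v1 := card_union_add_card_inter C A
  have v2 := card_union_add_card_inter (C ∪ A) B
  have v3 := card_union_add_card_inter (C ∪ A ∪ B) E
  have w2 : (C ∪ A) ∩ B = (C ∩ B) ∪ (A ∩ B) := by grind
  have w3 : (C ∪ A ∪ B) ∩ E = (C ∩ E) ∪ (A ∩ E) ∪ (B ∩ E) := by grind
  rw [w2] at v2
  rw [w3] at v3
  have x2 := card_union_add_card_inter (C ∩ B) (A ∩ B)
  have x3 := card_union_add_card_inter (C ∩ E) (A ∩ E)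
  have x4 := card_union_add_card_inter ((C ∩ E) ∪ (A ∩ E)) (B ∩ E)
  have y2 : (C ∩ B) ∩ (A ∩ B) = C ∩ A ∩ B := by grind
  have y3 : (C ∩ E) ∩ (A ∩ E) = C ∩ A ∩ E := by grind
  have y4 : ((C ∩ E) ∪ (A ∩ E)) ∩ (B ∩ E) = (C ∩ B ∩ E) ∪ (A ∩ B ∩ E) := by grind
  rw [y2] at x2
  rw [y3] at x3
  rw [y4] at x4
  have z := card_union_add_card_inter (C ∩ B ∩ E) (A ∩ B ∩ E)
  have z' : (C ∩ B ∩ E) ∩ (A ∩ B ∩ E) = C ∩ A ∩ B ∩ E := by grind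
  rw [z'] at z
  omega


lemma typ_arith (k c x y p t : ℕ) (hk : 3 ≤ k) (h1 : k ≤ c) (hx : x ≠ 0) (hy : y ≠ 0) (h4 : t ≤ x)
    (h5 : t ≤ y) (h6 : t ≤ p) (h7 : x + y ≤ c + t) (h8 : x + p ≤ k + t) (h9 : y + p ≤ k + t)
    (h10 : c ≤ k + x) (h11 : c ≤ k + y) (h12 : c + t ≤ x + y + p) (hpk : p < k)
    (hxc : x < c) (hyc : y < c) (hxk : x ≤ k) (hyk : y ≤ k)
    (h : x = 0 ∨ y = 0 ∨ p = 0 ∨ x + y ≤ 1 + t ∨ x + p ≤ 1 + t ∨ y + p ≤ 1 + t ∨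
      x + y + p ≤ 2 + 2 * t) :
    (p = 0 ∧ t = 0 ∧ x + y = c) ∨ (c = k ∧ x = 1 ∧ y = 1 ∧ t = 1 ∧ p + 1 = k) ∨
      (x = 1 ∧ p = 1 ∧ t = 1 ∧ y + 1 = c ∧ c ≤ k + 1) ∨
      (y = 1 ∧ p = 1 ∧ t = 1 ∧ x + 1 = c ∧ c ≤ k + 1) ∨
      (x = 2 ∧ y = 2 ∧ p = 2 ∧ t = 2 ∧ c ≤ 4) := by
  by_cases hp : p = 0
  · left; omega
  rcases h with h | h | h | h | h | h | h
  · omega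
  · omega
  · left; omega
  · right; left; omega
  · right; right; left; omega
  · right; right; right; left; omega
  · have : t = 0 ∨ t = 1 ∨ t = 2 := by omega
    rcases this with rfl | rfl | rfl
    · omega
    · omega
    · right; right; right; right; omega

open Finset in
lemma typ {n : ℕ} (k : ℕ) (C A B : Finset (Fin n)) (hk : 3 ≤ k) (hn : n = 2 * k) (hC : k ≤ #C)
    (hA : #A = k) (hB : #B = k) (hCA : C ≠ A) (hCB : C ≠ B) (hAB : A ≠ B)
    (iA : #(C ∩ A) ≠ 0) (iB : #(C ∩ B) ≠ 0) (t : ¬ BergeTriangle C A B) :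
    (#(A ∩ B) = 0 ∧ #(C ∩ A ∩ B) = 0 ∧ #(C ∩ A) + #(C ∩ B) = #C) ∨
    (#C = k ∧ #(C ∩ A) = 1 ∧ #(C ∩ B) = 1 ∧ #(C ∩ A ∩ B) = 1 ∧ #(A ∩ B) + 1 = k) ∨
    (#(C ∩ A) = 1 ∧ #(A ∩ B) = 1 ∧ #(C ∩ A ∩ B) = 1 ∧ #(C ∩ B) + 1 = #C ∧ #C ≤ k + 1) ∨
    (#(C ∩ B) = 1 ∧ #(A ∩ B) = 1 ∧ #(C ∩ A ∩ B) = 1 ∧ #(C ∩ A) + 1 = #C ∧ #C ≤ k + 1) ∨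
    (#(C ∩ A) = 2 ∧ #(C ∩ B) = 2 ∧ #(A ∩ B) = 2 ∧ #(C ∩ A ∩ B) = 2 ∧ #C ≤ 4) := by
  obtain ⟨f1, f2, f3, -, -, -, -, f8, f9, f10, f11, f12, f13, f14⟩ := facts3 C A B
  have t1 := nontri _ _ _ t hCA hCB hAB
  have n1 := ne_card hCA
  have n2 := ne_card hCB
  have n4 := ne_card hAB
  have i1 := inter_le C A
  have i2 := inter_le C B
  have i4 := inter_le A B
  subst hn
  clear t
  simp only [hA, hB] at f8 f9 f10 f11 f12 f13 f14 n1 n2 n4 i1 i2 i4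
  apply typ_arith k #C #(C ∩ A) #(C ∩ B) #(A ∩ B) #(C ∩ A ∩ B) hk hC iA iB f1 f2 f3 f8 f9 f10 <;>
    clear iA iB <;> first | assumption | (clear t1; omega)

lemma quad_arith (k c ca cb ce ab ae be t1 t2 t3 t4 s U : ℕ) (hk : 3 ≤ k) (hc : k ≤ c)
    (hU : U ≤ 2 * k)
    (h1 : (ab = 0 ∧ t1 = 0 ∧ ca + cb = c) ∨ (c = k ∧ ca = 1 ∧ cb = 1 ∧ t1 = 1 ∧ ab + 1 = k) ∨
      (ca = 1 ∧ ab = 1 ∧ t1 = 1 ∧ cb + 1 = c ∧ c ≤ k + 1) ∨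
      (cb = 1 ∧ ab = 1 ∧ t1 = 1 ∧ ca + 1 = c ∧ c ≤ k + 1) ∨
      (ca = 2 ∧ cb = 2 ∧ ab = 2 ∧ t1 = 2 ∧ c ≤ 4))
    (h2 : (ae = 0 ∧ t2 = 0 ∧ ca + ce = c) ∨ (c = k ∧ ca = 1 ∧ ce = 1 ∧ t2 = 1 ∧ ae + 1 = k) ∨
      (ca = 1 ∧ ae = 1 ∧ t2 = 1 ∧ ce + 1 = c ∧ c ≤ k + 1) ∨
      (ce = 1 ∧ ae = 1 ∧ t2 = 1 ∧ ca + 1 = c ∧ c ≤ k + 1) ∨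
      (ca = 2 ∧ ce = 2 ∧ ae = 2 ∧ t2 = 2 ∧ c ≤ 4))
    (h3 : (be = 0 ∧ t3 = 0 ∧ cb + ce = c) ∨ (c = k ∧ cb = 1 ∧ ce = 1 ∧ t3 = 1 ∧ be + 1 = k) ∨
      (cb = 1 ∧ be = 1 ∧ t3 = 1 ∧ ce + 1 = c ∧ c ≤ k + 1) ∨
      (ce = 1 ∧ be = 1 ∧ t3 = 1 ∧ cb + 1 = c ∧ c ≤ k + 1) ∨
      (cb = 2 ∧ ce = 2 ∧ be = 2 ∧ t3 = 2 ∧ c ≤ 4))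
    (h4 : ab = 0 ∨ ae = 0 ∨ (be = 0 ∧ t4 = 0 ∧ ab + ae = k) ∨
      (k = k ∧ ab = 1 ∧ ae = 1 ∧ t4 = 1 ∧ be + 1 = k) ∨
      (ab = 1 ∧ be = 1 ∧ t4 = 1 ∧ ae + 1 = k ∧ k ≤ k + 1) ∨
      (ae = 1 ∧ be = 1 ∧ t4 = 1 ∧ ab + 1 = k ∧ k ≤ k + 1) ∨
      (ab = 2 ∧ ae = 2 ∧ be = 2 ∧ t4 = 2 ∧ k ≤ 4))
    (ha : ab + ae ≤ k + t4) (hb : ab + be ≤ k + t4) (he : ae + be ≤ k + t4)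
    (hab : k + t4 ≤ ab + ae + be)
    (ja : c ≤ k + ca) (jb : c ≤ k + cb) (je : c ≤ k + ce)
    (g : s ≤ t1 ∧ s ≤ t2 ∧ s ≤ t3 ∧ s ≤ t4 ∧ t1 + t2 ≤ ca + s ∧ t1 + t3 ≤ cb + s ∧
      t2 + t3 ≤ ce + s ∧ t1 + t4 ≤ ab + s ∧ t2 + t4 ≤ ae + s ∧ t3 + t4 ≤ be + s ∧
      c + k + k + k + t1 + t2 + t3 + t4 = U + ca + cb + ce + ab + ae + be + s) :
    k = 3 ∧ c = 3 ∧ ca = 2 ∧ cb = 2 ∧ ce = 2 ∧ t1 = 2 ∧ t2 = 2 ∧ t3 = 2 ∧ t4 = 2 ∧ ab = 2 ∧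
      ae = 2 ∧ be = 2 ∧ U = 6 := by
  obtain ⟨g1, g2, g3, g4, g5, g6, g7, g8, g9, g10, g11⟩ := g
  rcases h1 with h1 | h1 | h1 | h1 | h1 <;> rcases h2 with h2 | h2 | h2 | h2 | h2 <;>
    try (exfalso; clear h4 h3; omega)
  all_goals rcases h3 with h3 | h3 | h3 | h3 | h3 
  all_goals try (exfalso; clear h4; omega)
  all_goals rcases h4 with h4 | h4 | h4 | h4 | h4 | h4 | h4
  all_goals try (exfalso; omega)
  all_goals omega


open Finset in
lemma quad {n : ℕ} (C A B E : Finset (Fin n)) (hn : 6 ≤ n) (hC : n ≤ 2 * #C) (hA : n = 2 * #A)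
    (hB : n = 2 * #B) (hE : n = 2 * #E) (hCA : C ≠ A) (hCB : C ≠ B) (hCE : C ≠ E) (hAB : A ≠ B)
    (hAE : A ≠ E) (hBE : B ≠ E) (iA : #(C ∩ A) ≠ 0) (iB : #(C ∩ B) ≠ 0) (iE : #(C ∩ E) ≠ 0)
    (t1 : ¬ BergeTriangle C A B) (t2 : ¬ BergeTriangle C A E) (t3 : ¬ BergeTriangle C B E)
    (t4 : ¬ BergeTriangle A B E) :
    #A = 3 ∧ #C = 3 ∧ #(C ∩ A) = 2 ∧ #(C ∩ B) = 2 ∧ #(C ∩ E) = 2 ∧ #(C ∩ A ∩ B) = 2 ∧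
     #(C ∩ A ∩ E) = 2 ∧ #(C ∩ B ∩ E) = 2 ∧ #(A ∩ B ∩ E) = 2 ∧ #(A ∩ B) = 2 ∧ #(A ∩ E) = 2 ∧
     #(B ∩ E) = 2 ∧ #(C ∪ A ∪ B ∪ E) = 6 := by
  have hk3 : 3 ≤ #A := by omega
  have hB' : #B = #A := by omega
  have hE' : #E = #A := by omega
  have hC' : #A ≤ #C := by omega
  have u := card_finset_fin_le (C ∪ A ∪ B ∪ E)
  have s1 := typ #A C A B hk3 hA hC' rfl hB' hCA hCB hAB iA iB t1
  have s2 := typ #A C A E hk3 hA hC' rfl hE' hCA hCE hAE iA iE t2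
  have s3 := typ #A C B E hk3 hA hC' hB' hE' hCB hCE hBE iB iE t3
  have s4 := or_iff_not_imp_left.2 fun h1 : ¬ #(A ∩ B) = 0 =>
    or_iff_not_imp_left.2 fun h2 : ¬ #(A ∩ E) = 0 =>
      typ #A A B E hk3 hA le_rfl hB' hE' hAB hAE hBE h1 h2 t4
  obtain ⟨-, -, -, -, -, -, -, f8, f9, f10, -, -, -, f14⟩ := facts3 A B E
  obtain ⟨-, -, -, -, -, -, -, -, -, -, a1, a2, -, -⟩ := facts3 C A B
  obtain ⟨-, -, -, -, -, -, -, -, -, -, -, a3, -, -⟩ := facts3 C A E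
  have g := facts4 C A B E
  have i1 := (inter_le C A).2
  have i2 := (inter_le C B).2
  have i3 := (inter_le C E).2
  rw [hB'] at f9 i2 a2 f14 g
  rw [hE'] at f10 i3 a3 f14 g
  refine quad_arith #A #C _ _ _ _ _ _ _ _ _ _ _ _ hk3 hC' (hA ▸ u) s1 s2 s3 s4 f8 f9 f10 ?_
    ?_ ?_ ?_ g <;> clear s1 s2 s3 s4 g <;> omega

open Finset in
lemma no_five {n : ℕ} (hn : 6 ≤ n) (M : Finset (Finset (Fin n))) (hM : ∀ A ∈ M, n = 2 * #A)
    (hT : ∀ A ∈ M, ∀ B ∈ M, ∀ C ∈ M, ¬ BergeTriangle A B C) : #M ≤ 4 := by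
  by_contra hc
  obtain ⟨G, hGM, hG⟩ := exists_subset_card_eq (show 5 ≤ #M by omega)
  have key : ∀ C ∈ G, Cᶜ ∈ G := by
    intro C hC
    by_contra hCc
    have hne : ∀ A ∈ G, #(C ∩ A) ≠ 0 := by
      intro A hA h0
      apply hCc
      have h1 : A ⊆ Cᶜ := by
        rw [card_eq_zero] at h0
        intro x hx
        rw [mem_compl]
        intro hxC
        have : x ∈ C ∩ A := mem_inter.2 ⟨hxC, hx⟩
        simp [h0] at this
      have h2 : A = Cᶜ := by
        apply eq_of_subset_of_card_le h1
        rw [card_compl, Fintype.card_fin]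
        have := hM A (hGM hA)
        have := hM C (hGM hC)
        omega
      exact h2 ▸ hA
    have h4 : #(G.erase C) = 4 := by rw [card_erase_of_mem hC, hG]
    obtain ⟨A, hA, B, hB, E, hE, hAB, hAE, hBE⟩ := two_lt_card.1 (show 2 < #(G.erase C) by omega)
    obtain ⟨F, hF, hF'⟩ := exists_mem_notMem_of_card_lt_card
      (show #({A, B, E} : Finset (Finset (Fin n))) < #(G.erase C) from
        lt_of_le_of_lt card_le_three (by omega))
    simp only [mem_insert, mem_singleton, not_or] at hF'
    obtain ⟨hFA, hFB, hFE⟩ := hF'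
    rw [mem_erase] at hA hB hE hF
    have q : ∀ X Y Z, X ∈ G → Y ∈ G → Z ∈ G → X ≠ C → Y ≠ C → Z ≠ C → X ≠ Y → X ≠ Z → Y ≠ Z → _ :=
      fun X Y Z hX hY hZ hXC hYC hZC hXY hXZ hYZ => quad C X Y Z hn (hM C (hGM hC)).le
        (hM X (hGM hX)) (hM Y (hGM hY)) (hM Z (hGM hZ)) hXC.symm hYC.symm hZC.symm hXY hXZ hYZ
        (hne X hX) (hne Y hY) (hne Z hZ)
        (hT _ (hGM hC) _ (hGM hX) _ (hGM hY)) (hT _ (hGM hC) _ (hGM hX) _ (hGM hZ))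
        (hT _ (hGM hC) _ (hGM hY) _ (hGM hZ)) (hT _ (hGM hX) _ (hGM hY) _ (hGM hZ))
    have q1 := q A B E hA.2 hB.2 hE.2 hA.1 hB.1 hE.1 hAB hAE hBE
    have q2 := q A B F hA.2 hB.2 hF.2 hA.1 hB.1 hF.1 hAB (Ne.symm hFA) (Ne.symm hFB)
    have q3 := q A E F hA.2 hE.2 hF.2 hA.1 hE.1 hF.1 hAE (Ne.symm hFA) (Ne.symm hFE)
    have hF3 : #F = 3 := by
      have := hM F (hGM hF.2)
      have := hM C (hGM hC)
      omega
    have hn6 : n = 6 := by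
      have := hM F (hGM hF.2)
      omega
    have hU : C ∪ A ∪ B ∪ E = univ := by
      rw [← card_eq_iff_eq_univ, Fintype.card_fin]
      omega
    have z : ∀ X, #(C ∩ X ∩ F) = 2 → #(X ∩ F) = 2 → X ∩ F ⊆ C ∩ F := by
      intro X h1 h2
      have : C ∩ X ∩ F = X ∩ F := eq_of_subset_of_card_le
        (inter_subset_inter inter_subset_right (Subset.refl F)) (by omega)
      rw [← this]
      exact inter_subset_inter inter_subset_left (Subset.refl F)
    have z1 := z A (by omega) (by omega)
    have z2 := z B (by omega) (by omega)
    have z3 := z E (by omega) (by omega)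
    have hsub : F ⊆ C ∩ F := by
      intro x hx
      have hxU : x ∈ C ∪ A ∪ B ∪ E := by rw [hU]; exact mem_univ x
      simp only [mem_union] at hxU
      rcases hxU with ((h | h) | h) | h
      · exact mem_inter.2 ⟨h, hx⟩
      · exact z1 (mem_inter.2 ⟨h, hx⟩)
      · exact z2 (mem_inter.2 ⟨h, hx⟩)
      · exact z3 (mem_inter.2 ⟨h, hx⟩)
    have := card_le_card hsub
    omega
  have hs := Finset.sum_involution (s := G) (f := fun _ => (1 : ZMod 2)) (fun C _ => Cᶜ)
    (fun _ _ => by decide) (fun C hC _ h => by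
      have h1 := hM C (hGM hC)
      have : (⟨0, by omega⟩ : Fin n) ∈ Cᶜ ↔ (⟨0, by omega⟩ : Fin n) ∈ C := by rw [h]
      rw [mem_compl] at this
      tauto) key (fun C _ => compl_compl C)
  rw [sum_const, hG] at hs
  revert hs
  decide

/-- weight -/
def wt {n : ℕ} (A : Finset (Fin n)) : ℕ :=
  if n < 2 * A.card then 2 else if n = 2 * A.card then 1 else 0

open Finset in
lemma sum_wt {n : ℕ} (F : Finset (Finset (Fin n))) :
    ∑ A ∈ F, wt A = 2 * #{A ∈ F | n < 2 * #A} + #{A ∈ F | n = 2 * #A} := by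
  rw [card_filter, card_filter, mul_sum, ← sum_add_distrib]
  apply sum_congr rfl
  intro A _
  unfold wt
  split_ifs <;> omega

open Finset in
lemma total_wt (n : ℕ) : ∑ A : Finset (Fin n), wt A = 2 ^ n := by
  have h1 : ∑ A : Finset (Fin n), wt A = ∑ A : Finset (Fin n), wt Aᶜ :=
    (Equiv.sum_comp (Equiv.ofBijective (compl : Finset (Fin n) → _) compl_bijective) wt).symm
  have h2 : ∑ A : Finset (Fin n), (wt A + wt Aᶜ) = 2 * 2 ^ n := by
    rw [sum_congr rfl (g := fun _ => 2)]
    · simp [mul_comm]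
    · intro A _
      have := card_finset_fin_le A
      unfold wt
      rw [card_compl, Fintype.card_fin]
      split_ifs <;> omega
  rw [sum_add_distrib, ← h1] at h2
  omega

open Finset in
lemma part_wt {n : ℕ} (hn : 6 ≤ n) (F : Finset (Finset (Fin n)))
    (hT : ∀ A ∈ F, ∀ B ∈ F, ∀ C ∈ F, ¬ BergeTriangle A B C) : ∑ A ∈ F, wt A ≤ 4 := by
  rw [sum_wt]
  have hL : #{A ∈ F | n < 2 * #A} ≤ 2 := by
    by_contra hc
    obtain ⟨A, hA, B, hB, C, hC, hAB, hAC, hBC⟩ := two_lt_card.1 (not_le.1 hc)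
    rw [mem_filter] at hA hB hC
    exact hT A hA.1 B hB.1 C hC.1
      (three_large (by omega) (by omega) A B C hA.2 hB.2 hC.2 hAB hAC hBC)
  have hM : #{A ∈ F | n = 2 * #A} ≤ 4 := by
    apply no_five hn
    · intro A hA
      exact (mem_filter.1 hA).2
    · intro A hA B hB C hC
      exact hT A (mem_filter.1 hA).1 B (mem_filter.1 hB).1 C (mem_filter.1 hC).1
  have hLM : 2 ≤ #{A ∈ F | n < 2 * #A} → #{A ∈ F | n = 2 * #A} = 0 := by
    intro h
    by_contra hc
    obtain ⟨A, hA, B, hB, hAB⟩ := one_lt_card.1 h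
    obtain ⟨C, hC⟩ := card_pos.1 (Nat.pos_of_ne_zero hc)
    rw [mem_filter] at hA hB hC
    exact hT A hA.1 B hB.1 C hC.1 (two_large hn A B C hA.2 hB.2 hC.2 hAB
      (by rintro rfl; omega) (by rintro rfl; omega))
  have hLM' : 1 ≤ #{A ∈ F | n < 2 * #A} → #{A ∈ F | n = 2 * #A} ≤ 2 := by
    intro h
    by_contra hc
    obtain ⟨C, hC⟩ := card_pos.1 h
    obtain ⟨A, hA, B, hB, E, hE, hAB, hAE, hBE⟩ := two_lt_card.1 (not_le.1 hc)
    rw [mem_filter] at hA hB hC hE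
    have hi : ∀ X, n = 2 * #X → #(C ∩ X) ≠ 0 := by
      intro X hX
      have := (facts3 C X X).2.2.2.2.2.2.2.2.2.2.1
      omega
    have := quad C A B E hn hC.2.le hA.2 hB.2 hE.2 (by rintro rfl; omega) (by rintro rfl; omega)
      (by rintro rfl; omega) hAB hAE hBE (hi _ hA.2) (hi _ hB.2) (hi _ hE.2)
      (hT _ hC.1 _ hA.1 _ hB.1) (hT _ hC.1 _ hA.1 _ hE.1) (hT _ hC.1 _ hB.1 _ hE.1)
      (hT _ hA.1 _ hB.1 _ hE.1)
    omega
  omega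

lemma typ4_arith (c x y p t : ℕ) (h1 : 3 ≤ c) (h4 : t ≤ x)
    (h5 : t ≤ y) (h6 : t ≤ p) (h7 : x + y ≤ c + t) (h8 : x + p ≤ 2 + t) (h9 : y + p ≤ 2 + t)
    (h10 : c ≤ 2 + x) (h11 : c ≤ 2 + y) (h12 : c + t ≤ x + y + p) (hpk : p < 2)
    (hxk : x ≤ 2) (hyk : y ≤ 2)
    (h : x = 0 ∨ y = 0 ∨ p = 0 ∨ x + y ≤ 1 + t ∨ x + p ≤ 1 + t ∨ y + p ≤ 1 + t ∨
      x + y + p ≤ 2 + 2 * t) : (c = 3 ∧ x + y = 3) ∨ p = 0 ∧ c = 4 := by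
  by_cases hp : p = 0
  · omega
  have : t = 0 ∨ t = 1 := by omega
  rcases this with rfl | rfl
  · rcases h with h | h | h | h | h | h | h <;> omega
  · rcases h with h | h | h | h | h | h | h <;> omega

open Finset in
lemma typ4 (C A B : Finset (Fin 4)) (hC : 4 < 2 * #C) (hA : #A = 2) (hB : #B = 2) (hAB : A ≠ B)
    (t : ¬ BergeTriangle C A B) : (#C = 3 ∧ #(C ∩ A) + #(C ∩ B) = 3) ∨ #(A ∩ B) = 0 ∧ #C = 4 := by
  obtain ⟨f1, f2, f3, -, -, -, -, f8, f9, f10, f11, f12, f13, f14⟩ := facts3 C A B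
  have t1 := nontri _ _ _ t (by rintro rfl; omega) (by rintro rfl; omega) hAB
  have n4 := ne_card hAB
  have i1 := (inter_le C A).2
  have i2 := (inter_le C B).2
  simp only [hA, hB] at f8 f9 f10 f11 f12 f13 f14 n4 i1 i2
  exact typ4_arith #C #(C ∩ A) #(C ∩ B) #(A ∩ B) #(C ∩ A ∩ B) (by omega) f1 f2 f3 f8 f9 f10
    (by clear t1; omega) (by clear t1; omega) (by clear t1; omega) (by clear t1; omega) i1 i2 t1

open Finset in
lemma two_large4 (A B C : Finset (Fin 4)) (hA : 4 < 2 * #A) (hB : 4 < 2 * #B) (hC : #C = 2)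
    (hAB : A ≠ B) (t : ¬ BergeTriangle A B C) : C = A ∩ B := by
  obtain ⟨f1, f2, f3, -, -, -, -, f8, f9, f10, f11, f12, f13, f14⟩ := facts3 A B C
  have t1 := nontri _ _ _ t hAB (by rintro rfl; omega) (by rintro rfl; omega)
  have n4 := ne_card hAB
  have i1 := inter_le A B
  have h : #(A ∩ B ∩ C) = 2 ∧ #(A ∩ B) = 2 := by
    rcases t1 with t1 | t1 | t1 | t1 | t1 | t1 | t1 <;> omega
  have h1 : A ∩ B ∩ C = A ∩ B := eq_of_subset_of_card_le inter_subset_left (by omega)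
  have h2 : A ∩ B ∩ C = C := eq_of_subset_of_card_le inter_subset_right (by omega)
  exact h2.symm.trans h1

open Finset in
lemma part_wt4 (F : Finset (Finset (Fin 4)))
    (hT : ∀ A ∈ F, ∀ B ∈ F, ∀ C ∈ F, ¬ BergeTriangle A B C) : ∑ A ∈ F, wt A ≤ 5 := by
  rw [sum_wt]
  have hL : #{A ∈ F | 4 < 2 * #A} ≤ 2 := by
    by_contra hc
    obtain ⟨A, hA, B, hB, C, hC, hAB, hAC, hBC⟩ := two_lt_card.1 (not_le.1 hc)
    rw [mem_filter] at hA hB hC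
    exact hT A hA.1 B hB.1 C hC.1
      (three_large (by omega) (by omega) A B C hA.2 hB.2 hC.2 hAB hAC hBC)
  have hM : #{A ∈ F | 4 = 2 * #A} ≤ 5 := by
    have hsub : {A ∈ F | 4 = 2 * #A} ⊆ powersetCard 2 univ := by
      intro A hA
      rw [mem_filter] at hA
      rw [mem_powersetCard]
      exact ⟨subset_univ _, by omega⟩
    have h6 : #(powersetCard 2 (univ : Finset (Fin 4))) = 6 := by decide
    by_contra hc
    have he := eq_of_subset_of_card_le hsub (by omega)
    have hm : ∀ A : Finset (Fin 4), #A = 2 → A ∈ F := by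
      intro A hA
      have : A ∈ powersetCard 2 (univ : Finset (Fin 4)) :=
        mem_powersetCard.2 ⟨subset_univ _, hA⟩
      rw [← he] at this
      exact (mem_filter.1 this).1
    refine hT {0, 1} (hm _ (by decide)) {0, 2} (hm _ (by decide)) {1, 2} (hm _ (by decide)) ?_
    exact ⟨by decide, by decide, by decide, 0, 1, 2, by decide⟩
  have hLM : 2 ≤ #{A ∈ F | 4 < 2 * #A} → #{A ∈ F | 4 = 2 * #A} ≤ 1 := by
    intro h
    by_contra hc
    obtain ⟨A, hA, B, hB, hAB⟩ := one_lt_card.1 h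
    obtain ⟨C, hC, D, hD, hCD⟩ := one_lt_card.1 (not_le.1 hc)
    rw [mem_filter] at hA hB hC hD
    exact hCD ((two_large4 A B C hA.2 hB.2 (by omega) hAB (hT _ hA.1 _ hB.1 _ hC.1)).trans
      (two_large4 A B D hA.2 hB.2 (by omega) hAB (hT _ hA.1 _ hB.1 _ hD.1)).symm)
  have hLM' : 1 ≤ #{A ∈ F | 4 < 2 * #A} → #{A ∈ F | 4 = 2 * #A} ≤ 2 := by
    intro h
    by_contra hc
    obtain ⟨C, hC⟩ := card_pos.1 h
    obtain ⟨A, hA, B, hB, E, hE, hAB, hAE, hBE⟩ := two_lt_card.1 (not_le.1 hc)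
    rw [mem_filter] at hA hB hC hE
    have t1 := typ4 C A B hC.2 (by omega) (by omega) hAB (hT _ hC.1 _ hA.1 _ hB.1)
    have t2 := typ4 C A E hC.2 (by omega) (by omega) hAE (hT _ hC.1 _ hA.1 _ hE.1)
    have t3 := typ4 C B E hC.2 (by omega) (by omega) hBE (hT _ hC.1 _ hB.1 _ hE.1)
    obtain ⟨f1, f2, f3, -, -, -, -, f8, f9, f10, f11, f12, f13, f14⟩ := facts3 A B E
    omega
  omega

open Finset in
lemma lower {n m b : ℕ} (hp : ∀ F : Finset (Finset (Fin n)),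
      (∀ A ∈ F, ∀ B ∈ F, ∀ C ∈ F, ¬ BergeTriangle A B C) → ∑ A ∈ F, wt A ≤ b)
    (hm : m * b < 2 ^ n) (c : Finset (Fin n) → Fin m) : ∃ i : Fin m, ¬ TriangleFree {A | c A = i} := by
  by_contra hc
  push Not at hc
  have h1 : ∑ A : Finset (Fin n), wt A = ∑ i : Fin m, ∑ A with c A = i, wt A :=
    (sum_fiberwise univ c wt).symm
  have h2 : ∑ i : Fin m, ∑ A with c A = i, wt A ≤ ∑ i : Fin m, b := by
    apply sum_le_sum
    intro i _
    apply hp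
    intro A hA B hB C hC
    exact hc i A (mem_filter.1 hA).2 B (mem_filter.1 hB).2 C (mem_filter.1 hC).2
  rw [← h1, total_wt] at h2
  simp at h2
  omega

open Finset in
lemma upper (m : ℕ) : ∃ c : Finset (Fin (m + 2)) → Fin (2 ^ m),
      ∀ i : Fin (2 ^ m), TriangleFree {A | c A = i} := by
  -- colour by the trace on the last `m` points, complemented when `1 ∈ A`
  let e : Finset (Fin m) ≃ Fin (2 ^ m) := Fintype.equivFinOfCardEq (by simp)
  let tr : Finset (Fin (m + 2)) → Finset (Fin m) := fun A =>
    univ.filter fun i => (i.succ.succ ∈ A ↔ (1 : Fin (m + 2)) ∉ A)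
  refine ⟨fun A => e (tr A), ?_⟩
  intro i A hA B hB C hC
  simp only [Set.mem_ofPred_eq] at hA hB hC
  have hAB : tr A = tr B := e.injective (hA.trans hB.symm)
  have hAC : tr A = tr C := e.injective (hA.trans hC.symm)
  have hBC : tr B = tr C := e.injective (hB.trans hC.symm)
  -- sets in a common class which differ at `1` meet at most in `0`
  have dis : ∀ X Y, tr X = tr Y → ∀ x, x ∈ X ∩ Y → x ≠ 0 → ((1 : Fin (m+2)) ∈ X ↔ 1 ∈ Y) := by
    intro X Y h x hx hx0
    rw [mem_inter] at hx
    obtain ⟨j, rfl⟩ := Fin.exists_succ_eq.2 hx0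
    induction j using Fin.cases with
    | zero => exact iff_of_true hx.1 hx.2
    | succ j =>
      have : j ∈ tr X ↔ j ∈ tr Y := by rw [h]
      simp only [tr, mem_filter, mem_univ, true_and] at this
      tauto
  have same : ∀ X Y, tr X = tr Y → ((1 : Fin (m+2)) ∈ X ↔ 1 ∈ Y) → 
      ((0 : Fin (m+2)) ∈ X ↔ 0 ∈ Y) → X = Y := by
    intro X Y h h1 h0
    ext x
    induction x using Fin.cases with
    | zero => exact h0
    | succ j =>
      induction j using Fin.cases with
      | zero => exact h1
      | succ j =>
        have : j ∈ tr X ↔ j ∈ tr Y := by rw [h]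
        simp only [tr, mem_filter, mem_univ, true_and] at this
        tauto
  rintro ⟨nAB, nAC, nBC, x, y, z, hxy, hxz, hyz, hx, hy, hz⟩
  have d1 := dis A B hAB x hx
  have d2 := dis A C hAC y hy
  have d3 := dis B C hBC z hz
  have s1 := fun h h' => nAB (same A B hAB h h')
  have s2 := fun h h' => nAC (same A C hAC h h')
  have s3 := fun h h' => nBC (same B C hBC h h')
  clear same dis hAB hAC hBC hA hB hC nAB nAC nBC hx hy hz
  have : ((1 : Fin (m+2)) ∈ A ↔ 1 ∈ B) ∧ ((1 : Fin (m+2)) ∈ A ↔ 1 ∈ C) ∧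
      ((1 : Fin (m+2)) ∈ B ↔ 1 ∈ C) := by
    by_cases x0 : x = 0
    · subst x0
      have h2 := d2 (Ne.symm hxy)
      have h3 := d3 (Ne.symm hxz)
      exact ⟨h2.trans h3.symm, h2, h3⟩
    · have h1 := d1 x0
      by_cases y0 : y = 0
      · subst y0
        have h3 := d3 (Ne.symm hyz)
        exact ⟨h1, h1.trans h3, h3⟩
      · have h2 := d2 y0
        exact ⟨h1, h2, h1.symm.trans h2⟩
  have s1 := s1 this.1
  have s2 := s2 this.2.1
  have s3 := s3 this.2.2
  clear this d1 d2 d3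
  by_cases a : (0 : Fin (m+2)) ∈ A <;> by_cases b : (0 : Fin (m+2)) ∈ B
  · exact s1 (iff_of_true a b)
  · by_cases c : (0 : Fin (m+2)) ∈ C
    · exact s2 (iff_of_true a c)
    · exact s3 (iff_of_false b c)
  · by_cases c : (0 : Fin (m+2)) ∈ C
    · exact s3 (iff_of_true b c)
    · exact s2 (iff_of_false a c)
  · exact s1 (iff_of_false a b)

/-- For every `n ≥ 3` with `n ≠ 5`, `f(n, C₃) = 2 ^ (n - 2)`: the power set of `[n]`
can be partitioned into `2 ^ (n - 2)` triangle-free parts, but in any partition into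
`2 ^ (n - 2) - 1` parts some part contains a Berge triangle. -/
theorem f_C3_eq (n : ℕ) (hn : 3 ≤ n) (hn5 : n ≠ 5) :
    (∃ c : Finset (Fin n) → Fin (2 ^ (n - 2)),
      ∀ i : Fin (2 ^ (n - 2)), TriangleFree {A | c A = i}) ∧
    (∀ c : Finset (Fin n) → Fin (2 ^ (n - 2) - 1),
      ∃ i : Fin (2 ^ (n - 2) - 1), ¬ TriangleFree {A | c A = i}) := by
  refine ⟨?_, ?_⟩
  · obtain ⟨m, rfl⟩ : ∃ m, n = m + 2 := ⟨n - 2, by omega⟩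
    exact upper m
  · rcases (by omega : n = 3 ∨ n = 4 ∨ 6 ≤ n) with rfl | rfl | h6
    · intro c
      refine ⟨c ∅, fun h => ?_⟩
      have hs : ∀ X Y : Finset (Fin 3), c X = c Y := fun X Y => Subsingleton.elim (α := Fin 1) _ _
      exact h {0, 1} (hs _ _) {0, 2} (hs _ _) {1, 2} (hs _ _)
        ⟨by decide, by decide, by decide, 0, 1, 2, by decide⟩
    · exact lower part_wt4 (by norm_num)
    · apply lower (part_wt h6)
      obtain ⟨m, rfl⟩ : ∃ m, n = m + 2 := ⟨n - 2, by omega⟩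
      have : 0 < 2 ^ m := by positivity
      rw [Nat.add_sub_cancel, pow_add]
      omega
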